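/- Let k be a commutative ring and A a commutative k-algebra, J ⊆ A an ideal, S = A/J, and suppose both A and S are flat as k-modules. Then the following sequence of (S⊗_kS)-modules is exact: 0 → J/J² → I_{Δ_A} ⊗_{A⊗_kA} (S⊗_kS) → S⊗_kS → S → 0, where the first map sends the class of j ∈ J to (1⊗j − j⊗1)⊗1 (note 1⊗j − j⊗1 ∈ I_{Δ_A}), the second map is induced by the inclusion I_{Δ_A} ⊆ A⊗_kA followed by the quotient A⊗_kA → S⊗_kS, and the last map is the multiplication μ_S: S⊗_kS → S. In particular, the kernel of the natural surjection I_{Δ_A} ⊗_{A⊗_kA} (S⊗_kS) → I_{Δ_S} is isomorphic to J/J². (This is the affine form of: for a closed embedding X ⊆ A with ideal sheaf J, the kernel of I_{Δ_A}|_{X×X} → I_{Δ_X} is isomorphic to the pushforward of J/J² from the diagonal.) -/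

import Mathlib

/-!
STATEMENT 2 (affine form of Lemma `lem:k`): For `k → A` with `A`, `S = A/J` flat over
`k`, the sequence `0 → J/J² → I_{Δ_A} ⊗_{A⊗A} (S⊗S) → S⊗S → S → 0` is exact, where the
first map sends the class of `j` to `(1⊗j − j⊗1) ⊗ 1`, the second is induced by the
inclusion `I_{Δ_A} ⊆ A⊗A` and the quotient `A⊗A → S⊗S`, and the third is `μ_S`.
Exactness at the first two spots is expressed via the map `δ : J → I_{Δ_A} ⊗ (S⊗S)`:
well-definedness and injectivity of the induced map on `J/J²` amount to
`δ j = 0 ↔ j ∈ J²`, and the image of the induced map is the image of `δ`.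
-/

open TensorProduct

noncomputable section

variable (k A : Type) [CommRing k] [CommRing A] [Algebra k A] (J : Ideal A)

/-- The ideal `I_{Δ_A}` of the diagonal: the kernel of `μ_A : A ⊗[k] A → A`. -/
abbrev diagIdeal : Ideal (A ⊗[k] A) := KaehlerDifferential.ideal k A

/-- The quotient map `π : A → S = A/J`. -/
abbrev qmap : A →ₐ[k] A ⧸ J := Ideal.Quotient.mkₐ k J

/-- The map `π ⊗ π : A ⊗[k] A → S ⊗[k] S`. -/
abbrev toSS : A ⊗[k] A →ₐ[k] (A ⧸ J) ⊗[k] (A ⧸ J) :=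
  Algebra.TensorProduct.map (qmap k A J) (qmap k A J)

/-- `S ⊗[k] S` as an `(A ⊗[k] A)`-algebra via `π ⊗ π`. -/
def SSalgebra : Algebra (A ⊗[k] A) ((A ⧸ J) ⊗[k] (A ⧸ J)) := (toSS k A J).toRingHom.toAlgebra

attribute [local instance] SSalgebra

/-- The map `J → I_{Δ_A} ⊗_{A⊗A} (S ⊗[k] S)` sending `j` to `(1 ⊗ j − j ⊗ 1) ⊗ 1`;
the first map of the four-term sequence is the map on `J/J²` induced by it. -/
def deltaMap (j : J) : (diagIdeal k A) ⊗[A ⊗[k] A] ((A ⧸ J) ⊗[k] (A ⧸ J)) :=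
  (⟨(1 : A) ⊗ₜ[k] (j : A) - (j : A) ⊗ₜ[k] (1 : A),
      KaehlerDifferential.one_smul_sub_smul_one_mem_ideal k (j : A)⟩ : diagIdeal k A) ⊗ₜ[A ⊗[k] A]
    (1 : (A ⧸ J) ⊗[k] (A ⧸ J))

/-- The natural map `I_{Δ_A} ⊗_{A⊗A} (S ⊗[k] S) → S ⊗[k] S`, induced by the inclusion
`I_{Δ_A} ⊆ A ⊗[k] A` followed by the quotient map `A ⊗[k] A → S ⊗[k] S`. -/
def incMap :
    (diagIdeal k A) ⊗[A ⊗[k] A] ((A ⧸ J) ⊗[k] (A ⧸ J)) →ₗ[A ⊗[k] A]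
      (A ⧸ J) ⊗[k] (A ⧸ J) :=
  TensorProduct.lift
    ((LinearMap.lsmul (A ⊗[k] A) ((A ⧸ J) ⊗[k] (A ⧸ J))).comp
      (Submodule.subtype (diagIdeal k A)))

/-- The multiplication map `μ_S : S ⊗[k] S → S`. -/
abbrev mulMapS : (A ⧸ J) ⊗[k] (A ⧸ J) →ₐ[k] A ⧸ J := Algebra.TensorProduct.lmul' k

open Algebra.TensorProduct in
/-- If `A ⧸ J` is flat then `(J ⊗ A) ∩ (A ⊗ J)` is the image of `J ⊗ J`; hence multiplication
sends it into `J ^ 2`. -/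
lemma lmul'_mem_sq [Module.Flat k (A ⧸ J)] {x : A ⊗[k] A}
    (hL : x ∈ J.map (includeLeft : A →ₐ[k] A ⊗[k] A))
    (hR : x ∈ J.map (includeRight : A →ₐ[k] A ⊗[k] A)) :
    lmul' (S := A) k x ∈ J ^ 2 := by
  obtain ⟨w, rfl⟩ := J.map_includeRight_eq.le hR
  have hL' : LinearMap.rTensor A (qmap k A J).toLinearMap
      (LinearMap.lTensor A (J.restrictScalars k).subtype w) = 0 := by
    obtain ⟨v, hv⟩ := J.map_includeLeft_eq.le hL
    rw [← hv, ← LinearMap.comp_apply, ← LinearMap.rTensor_comp]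
    have h : (qmap k A J).toLinearMap ∘ₗ (J.restrictScalars k).subtype = 0 := by
      ext y
      exact Ideal.Quotient.eq_zero_iff_mem.mpr y.2
    rw [h, LinearMap.rTensor_zero, LinearMap.zero_apply]
  have hw : LinearMap.rTensor (J.restrictScalars k) (qmap k A J).toLinearMap w = 0 := by
    apply Module.Flat.lTensor_preserves_injective_linearMap (M := A ⧸ J)
      (J.restrictScalars k).subtype (Submodule.injective_subtype _)
    rw [map_zero, ← hL', ← LinearMap.comp_apply, ← LinearMap.comp_apply,
      LinearMap.lTensor_comp_rTensor, LinearMap.rTensor_comp_lTensor]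
  have hex : Function.Exact (J.restrictScalars k).subtype (qmap k A J).toLinearMap := by
    intro y
    refine Ideal.Quotient.eq_zero_iff_mem.trans ⟨fun h => ⟨⟨y, h⟩, rfl⟩, ?_⟩
    rintro ⟨z, rfl⟩
    exact z.2
  obtain ⟨z, rfl⟩ := (rTensor_exact (J.restrictScalars k) hex
    (Ideal.Quotient.mkₐ_surjective k J) w).mp hw
  clear hw hL' hR hL
  induction z with
  | zero => simp
  | add a b ha hb => simpa only [map_add] using add_mem ha hb
  | tmul a b =>
    simpa [sq] using Ideal.mul_mem_mul a.2 b.2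

/-- The kernel of `π ⊗ π` is generated by `J ⊗ 1` and `1 ⊗ J`. -/
lemma ker_toSS : RingHom.ker (toSS k A J) =
    J.map (Algebra.TensorProduct.includeLeft : A →ₐ[k] A ⊗[k] A) ⊔
      J.map (Algebra.TensorProduct.includeRight : A →ₐ[k] A ⊗[k] A) := by
  have h := Algebra.TensorProduct.map_ker (qmap k A J) (qmap k A J)
    (Ideal.Quotient.mkₐ_surjective k J) (Ideal.Quotient.mkₐ_surjective k J)
  rwa [show RingHom.ker (qmap k A J) = J from Ideal.Quotient.mkₐ_ker k J] at h

/-- Modulo `ker μ * J.map s`, an element `x` of the extension of `J` along a section `s` of `μ`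
agrees with `s (μ x)`. -/
lemma Ideal.sub_section_mem_ker_mul_map {A B : Type*} [CommRing A] [CommRing B]
    (μ : B →+* A) (s : A →+* B) (hs : ∀ a, μ (s a) = a) (J : Ideal A) {x : B}
    (hx : x ∈ J.map s) : μ x ∈ J ∧ x - s (μ x) ∈ RingHom.ker μ * J.map s := by
  refine Submodule.span_induction ?_ ?_ ?_ ?_ hx
  · rintro _ ⟨j, hj, rfl⟩
    simpa [hs] using hj
  · simp
  · rintro x y - - ⟨hx, hx'⟩ ⟨hy, hy'⟩
    rw [map_add, map_add, add_sub_add_comm]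
    exact ⟨add_mem hx hy, add_mem hx' hy'⟩
  · rintro b x - ⟨hx, hx'⟩
    rw [smul_eq_mul, map_mul, map_mul]
    refine ⟨J.mul_mem_left _ hx, ?_⟩
    have h : b * x - s (μ b) * s (μ x) = b * (x - s (μ x)) + (b - s (μ b)) * s (μ x) := by ring
    rw [h]
    refine add_mem (Ideal.mul_mem_left _ _ hx') (Ideal.mul_mem_mul ?_ (Ideal.mem_map_of_mem s hx))
    simp [RingHom.mem_ker, hs]

/-- For `C = B ⧸ K`, a pure tensor `x ⊗ 1 ∈ I ⊗ C` vanishes iff `x ∈ I * K`. -/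
lemma Ideal.tmul_one_eq_zero_iff {B C : Type*} [CommRing B] [CommRing C] [Algebra B C]
    (hsurj : Function.Surjective (algebraMap B C)) (I : Ideal B) (x : I) :
    x ⊗ₜ[B] (1 : C) = 0 ↔ (x : B) ∈ I * RingHom.ker (algebraMap B C) := by
  constructor
  · intro h
    have hex : Function.Exact (RingHom.ker (algebraMap B C)).subtype (Algebra.linearMap B C) := by
      intro y
      refine ⟨fun h => ⟨⟨y, h⟩, rfl⟩, ?_⟩
      rintro ⟨z, rfl⟩
      exact z.2
    obtain ⟨z, hz⟩ := (lTensor_exact I hex hsurj (x ⊗ₜ[B] (1 : B))).mp (by simpa using h)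
    have hx := congrArg (TensorProduct.lift ((LinearMap.mul B B).comp I.subtype)) hz
    simp only [TensorProduct.lift.tmul, LinearMap.comp_apply, Submodule.subtype_apply,
      LinearMap.mul_apply', mul_one] at hx
    rw [← hx]
    clear hx hz
    induction z with
    | zero => simp
    | add a b ha hb => simpa only [map_add] using add_mem ha hb
    | tmul a b => simpa using Ideal.mul_mem_mul a.2 b.2
  · intro h
    obtain ⟨x, hx⟩ := x
    suffices ∀ y ∈ I * RingHom.ker (algebraMap B C),
        ∃ hy : y ∈ I, (⟨y, hy⟩ : I) ⊗ₜ[B] (1 : C) = 0 from (this x h).2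
    intro y hy
    refine Submodule.mul_induction_on hy ?_ ?_
    · intro m hm n hn
      refine ⟨I.mul_mem_right _ hm, ?_⟩
      have e : (⟨m * n, I.mul_mem_right _ hm⟩ : I) = n • ⟨m, hm⟩ :=
        Subtype.ext (mul_comm m n)
      rw [e, TensorProduct.smul_tmul, Algebra.smul_def, RingHom.mem_ker.mp hn, zero_mul,
        TensorProduct.tmul_zero]
    · rintro x y ⟨hx, hx'⟩ ⟨hy, hy'⟩
      refine ⟨add_mem hx hy, ?_⟩
      have e : (⟨x + y, add_mem hx hy⟩ : I) = ⟨x, hx⟩ + ⟨y, hy⟩ := rfl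
      rw [e, TensorProduct.add_tmul, hx', hy', add_zero]

/-- If `B → C` is surjective, every element of `M ⊗[B] C` is of the form `m ⊗ 1`. -/
lemma TensorProduct.exists_tmul_one_eq {B C M : Type*} [CommRing B] [CommRing C] [Algebra B C]
    [AddCommGroup M] [Module B M] (hsurj : Function.Surjective (algebraMap B C))
    (t : M ⊗[B] C) : ∃ m : M, m ⊗ₜ[B] (1 : C) = t := by
  induction t with
  | zero => exact ⟨0, TensorProduct.zero_tmul _ _⟩
  | add a b ha hb =>
    obtain ⟨a, rfl⟩ := ha
    obtain ⟨b, rfl⟩ := hb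
    exact ⟨a + b, TensorProduct.add_tmul _ _ _⟩
  | tmul m c =>
    obtain ⟨b, rfl⟩ := hsurj c
    exact ⟨b • m, by rw [TensorProduct.smul_tmul, Algebra.algebraMap_eq_smul_one]⟩

lemma algebraMap_toSS_surjective :
    Function.Surjective (algebraMap (A ⊗[k] A) ((A ⧸ J) ⊗[k] (A ⧸ J))) :=
  Algebra.TensorProduct.map_surjective _ _
    (Ideal.Quotient.mkₐ_surjective k J) (Ideal.Quotient.mkₐ_surjective k J)

lemma incMap_tmul_one (x : diagIdeal k A) :
    incMap k A J (x ⊗ₜ 1) = toSS k A J x := by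
  change (x : A ⊗[k] A) • (1 : (A ⧸ J) ⊗[k] (A ⧸ J)) = _
  rw [Algebra.smul_def, mul_one]
  rfl

lemma mulMapS_toSS (x : A ⊗[k] A) :
    mulMapS k A J (toSS k A J x) = qmap k A J (Algebra.TensorProduct.lmul' k x) := by
  rw [← AlgHom.comp_apply, ← AlgHom.comp_apply]
  congr 1
  ext <;> simp

lemma tmul_one_eq_zero_iff (x : diagIdeal k A) :
    x ⊗ₜ[A ⊗[k] A] (1 : (A ⧸ J) ⊗[k] (A ⧸ J)) = 0 ↔
      (x : A ⊗[k] A) ∈ diagIdeal k A *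
        (J.map (Algebra.TensorProduct.includeLeft : A →ₐ[k] A ⊗[k] A) ⊔
          J.map (Algebra.TensorProduct.includeRight : A →ₐ[k] A ⊗[k] A)) := by
  rw [← ker_toSS]
  exact Ideal.tmul_one_eq_zero_iff (algebraMap_toSS_surjective k A J) _ x

lemma deltaMap_eq_zero_of_mem_sq {j : J} (hj : (j : A) ∈ J ^ 2) : deltaMap k A J j = 0 := by
  refine (tmul_one_eq_zero_iff k A J _).mpr ?_
  obtain ⟨j, hjJ⟩ := j
  change (1 : A) ⊗ₜ[k] j - j ⊗ₜ[k] (1 : A) ∈ _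
  replace hj : j ∈ J * J := sq J ▸ hj
  clear hjJ
  refine Submodule.mul_induction_on hj ?_ ?_
  · intro a ha b hb
    have h : (1 : A) ⊗ₜ[k] (a * b) - (a * b) ⊗ₜ[k] (1 : A) =
        (1 ⊗ₜ b - b ⊗ₜ 1) * (1 ⊗ₜ a) + (1 ⊗ₜ a - a ⊗ₜ 1) * (b ⊗ₜ 1) := by
      simp only [sub_mul, Algebra.TensorProduct.tmul_mul_tmul, one_mul, mul_one, mul_comm b a]
      ring
    rw [h]
    refine add_mem (Ideal.mul_mem_mul
        (KaehlerDifferential.one_smul_sub_smul_one_mem_ideal k b) ?_)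
      (Ideal.mul_mem_mul (KaehlerDifferential.one_smul_sub_smul_one_mem_ideal k a) ?_)
    · exact Ideal.mem_sup_right (Ideal.mem_map_of_mem _ ha)
    · exact Ideal.mem_sup_left (Ideal.mem_map_of_mem _ hb)
  · intro x y hx hy
    rw [TensorProduct.tmul_add, TensorProduct.add_tmul, add_sub_add_comm]
    exact add_mem hx hy

lemma mem_sq_of_deltaMap_eq_zero [Module.Flat k (A ⧸ J)] {j : J} (h : deltaMap k A J j = 0) :
    (j : A) ∈ J ^ 2 := by
  have h' := (tmul_one_eq_zero_iff k A J _).mp h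
  rw [Ideal.mul_sup] at h'
  obtain ⟨u, hu, v, hv, huv⟩ := Submodule.mem_sup.mp h'
  have hvI : Algebra.TensorProduct.lmul' (S := A) k v = 0 := Ideal.mul_le_left hv
  have e : (1 : A) ⊗ₜ[k] (j : A) - v = u + (j : A) ⊗ₜ[k] (1 : A) := by
    linear_combination -huv
  have key := lmul'_mem_sq k A J (x := (1 : A) ⊗ₜ[k] (j : A) - v)
    (by rw [e]; exact add_mem (Ideal.mul_le_right hu) (Ideal.mem_map_of_mem _ j.2))
    (sub_mem (Ideal.mem_map_of_mem _ j.2) (Ideal.mul_le_right hv))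
  rw [map_sub, hvI] at key
  simpa using key

lemma exact_deltaMap_incMap : Function.Exact (deltaMap k A J) (incMap k A J) := by
  intro t
  constructor
  · intro ht
    obtain ⟨x, rfl⟩ := TensorProduct.exists_tmul_one_eq (algebraMap_toSS_surjective k A J) t
    rw [incMap_tmul_one, ← RingHom.mem_ker, ker_toSS] at ht
    obtain ⟨u, hu, v, hv, huv⟩ := Submodule.mem_sup.mp ht
    have hμ : Algebra.TensorProduct.lmul' (S := A) k u +
        Algebra.TensorProduct.lmul' (S := A) k v = 0 := by
      rw [← map_add, huv]
      exact x.2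
    obtain ⟨-, hu'⟩ := Ideal.sub_section_mem_ker_mul_map
      (Algebra.TensorProduct.lmul' (S := A) k).toRingHom
      (Algebra.TensorProduct.includeLeft : A →ₐ[k] A ⊗[k] A).toRingHom (by simp) J hu
    obtain ⟨hvJ, hv'⟩ := Ideal.sub_section_mem_ker_mul_map
      (Algebra.TensorProduct.lmul' (S := A) k).toRingHom
      (Algebra.TensorProduct.includeRight : A →ₐ[k] A ⊗[k] A).toRingHom (by simp) J hv
    refine ⟨⟨_, hvJ⟩, ?_⟩
    rw [eq_comm, ← sub_eq_zero, deltaMap, ← TensorProduct.sub_tmul, tmul_one_eq_zero_iff,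
      Ideal.mul_sup]
    have key := Submodule.add_mem_sup hu' hv'
    have e : (x : A ⊗[k] A) - ((1 : A) ⊗ₜ[k] (Algebra.TensorProduct.lmul' (S := A) k v) -
      (Algebra.TensorProduct.lmul' (S := A) k v) ⊗ₜ[k] (1 : A)) =
      u - (Algebra.TensorProduct.lmul' (S := A) k u) ⊗ₜ[k] (1 : A) +
        (v - (1 : A) ⊗ₜ[k] (Algebra.TensorProduct.lmul' (S := A) k v)) := by
      rw [← huv, eq_neg_of_add_eq_zero_left hμ, TensorProduct.neg_tmul]
      ring
    exact Set.mem_of_eq_of_mem e key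
  · rintro ⟨j, rfl⟩
    have hj : qmap k A J j = 0 := Ideal.Quotient.eq_zero_iff_mem.mpr j.2
    rw [deltaMap, incMap_tmul_one, map_sub, Algebra.TensorProduct.map_tmul,
      Algebra.TensorProduct.map_tmul, hj, TensorProduct.tmul_zero, TensorProduct.zero_tmul,
      sub_zero]

lemma exact_incMap_mulMapS : Function.Exact (incMap k A J) (mulMapS k A J) := by
  intro y
  constructor
  · intro hy
    obtain ⟨b, rfl⟩ : ∃ b, toSS k A J b = y := algebraMap_toSS_surjective k A J y
    rw [mulMapS_toSS] at hy
    set a := Algebra.TensorProduct.lmul' (S := A) k b with ha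
    have hb : b - a ⊗ₜ[k] (1 : A) ∈ diagIdeal k A := by
      change Algebra.TensorProduct.lmul' (S := A) k _ = 0
      simp [ha]
    refine ⟨(⟨_, hb⟩ : diagIdeal k A) ⊗ₜ 1, ?_⟩
    rw [incMap_tmul_one, map_sub, Algebra.TensorProduct.map_tmul, hy, TensorProduct.zero_tmul,
      sub_zero]
  · rintro ⟨t, rfl⟩
    obtain ⟨x, rfl⟩ := TensorProduct.exists_tmul_one_eq (algebraMap_toSS_surjective k A J) t
    have hx : Algebra.TensorProduct.lmul' (S := A) k (x : A ⊗[k] A) = 0 := x.2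
    rw [incMap_tmul_one, mulMapS_toSS, hx, map_zero]

theorem statement2 [Module.Flat k A] [Module.Flat k (A ⧸ J)] :
    (∀ j : J, deltaMap k A J j = 0 ↔ (j : A) ∈ J ^ 2) ∧
      Function.Exact (deltaMap k A J) (incMap k A J) ∧
      Function.Exact (incMap k A J) (mulMapS k A J) ∧
      Function.Surjective (mulMapS k A J) := by
  exact ⟨fun j => ⟨mem_sq_of_deltaMap_eq_zero k A J, deltaMap_eq_zero_of_mem_sq k A J⟩,
    exact_deltaMap_incMap k A J, exact_incMap_mulMapS k A J,
    fun s => ⟨s ⊗ₜ 1, by simp⟩⟩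

end
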